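/- The Hausdorff dimension of the level set F(log 2) = {x ∈ (0,1] : lim_{n→∞} (1/n) ∑_{j=1}^{n} d_j(x)·log 2 = log 2} is 0. -/

import Mathlib

open MeasureTheory Filter Real Set

/-- The power-2-decaying Gauss-like expansion map: `T x = 2^n x - 1` for
`x ∈ (2^{-n}, 2^{-(n-1)}]`, where the branch index is `n = ⌊-log₂ x⌋ + 1`. -/
noncomputable def p2gleT (x : ℝ) : ℝ := 2 ^ (⌊-Real.logb 2 x⌋ + 1) * x - 1

/-- The `(j+1)`-th P2GLE digit: `d_{j+1}(x) = d₁(T^j x)` with `d₁(x) = ⌈-log₂ x⌉`. -/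
noncomputable def p2gleD (j : ℕ) (x : ℝ) : ℤ := ⌈-Real.logb 2 (p2gleT^[j] x)⌉

/-- The level set `E(ξ)` of points whose Khintchine exponent equals `ξ`. -/
noncomputable def khinchinLevelSet (ξ : ℝ) : Set ℝ :=
  {x ∈ Ioc (0:ℝ) 1 |
    Tendsto (fun n : ℕ => (∑ j ∈ Finset.range n, (p2gleD j x : ℝ)) / n) atTop (nhds ξ)}

/-- The level set `F(β)` of points whose Lyapunov exponent
`λ(x) = lim (1/n) ∑_{j=1}^n d_j(x)·log 2` equals `β`. -/
noncomputable def lyapLevelSet (β : ℝ) : Set ℝ :=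
  {x ∈ Ioc (0:ℝ) 1 |
    Tendsto (fun n : ℕ => (∑ j ∈ Finset.range n, (p2gleD j x : ℝ) * Real.log 2) / n)
      atTop (nhds β)}

theorem p2gleT_mem_Ioc {x : ℝ} (hx : x ∈ Ioc (0 : ℝ) 1) : p2gleT x ∈ Ioc (0 : ℝ) 1 := by
  obtain ⟨h0, -⟩ := hx
  have hpow : (2 : ℝ) ^ Real.logb 2 x = x := Real.rpow_logb (by norm_num) (by norm_num) h0
  set k := ⌊-Real.logb 2 x⌋ with hk
  have hprod : (2 : ℝ) ^ (k + 1) * x = (2 : ℝ) ^ ((k : ℝ) + 1 + Real.logb 2 x) := by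
    rw [Real.rpow_add (by norm_num), hpow, ← Real.rpow_intCast]
    push_cast
    rfl
  have h1 : 0 < (k : ℝ) + 1 + Real.logb 2 x := by
    linarith [Int.lt_floor_add_one (-Real.logb 2 x)]
  have h2 : (k : ℝ) + 1 + Real.logb 2 x ≤ 1 := by
    linarith [Int.floor_le (-Real.logb 2 x)]
  have h3 : (1 : ℝ) < 2 ^ ((k : ℝ) + 1 + Real.logb 2 x) :=
    Real.one_lt_rpow (by norm_num) h1
  have h4 : (2 : ℝ) ^ ((k : ℝ) + 1 + Real.logb 2 x) ≤ 2 ^ (1 : ℝ) :=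
    Real.rpow_le_rpow_of_exponent_le (by norm_num) h2
  rw [Real.rpow_one] at h4
  change 0 < 2 ^ (k + 1) * x - 1 ∧ 2 ^ (k + 1) * x - 1 ≤ 1
  rw [hprod]
  constructor <;> linarith

theorem p2gleT_iterate_mem_Ioc {x : ℝ} (hx : x ∈ Ioc (0 : ℝ) 1) (j : ℕ) :
    p2gleT^[j] x ∈ Ioc (0 : ℝ) 1 := by
  induction j with
  | zero => exact hx
  | succ j ih =>
    rw [Function.iterate_succ_apply']
    exact p2gleT_mem_Ioc ih

/-- The number of zeros preceding the `(j+1)`-th one in the binary expansion of `x`: one less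
than the branch index of `T^j x`. -/
noncomputable def p2gleGap (j : ℕ) (x : ℝ) : ℕ := ⌊-Real.logb 2 (p2gleT^[j] x)⌋₊

theorem neg_logb_two_nonneg {x : ℝ} (hx : x ∈ Ioc (0 : ℝ) 1) : 0 ≤ -Real.logb 2 x :=
  neg_nonneg.2 (Real.logb_nonpos (by norm_num) hx.1.le hx.2)

theorem natCast_p2gleGap {x : ℝ} (hx : x ∈ Ioc (0 : ℝ) 1) (j : ℕ) :
    (p2gleGap j x : ℤ) = ⌊-Real.logb 2 (p2gleT^[j] x)⌋ :=
  Int.natCast_floor_eq_floor (neg_logb_two_nonneg (p2gleT_iterate_mem_Ioc hx j))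

theorem abs_sub_le_of_p2gleGap_eq {n : ℕ} {x y : ℝ} (hx : x ∈ Ioc (0 : ℝ) 1)
    (hy : y ∈ Ioc (0 : ℝ) 1) (h : ∀ j < n, p2gleGap j x = p2gleGap j y) :
    |x - y| ≤ (1 / 2) ^ n := by
  induction n generalizing x y with
  | zero =>
    rw [pow_zero, abs_le]
    constructor <;> linarith [hx.1, hx.2, hy.1, hy.2]
  | succ n ih =>
    have hT := ih (p2gleT_mem_Ioc hx) (p2gleT_mem_Ioc hy) fun j hj => h (j + 1) (by omega)
    have hfx := natCast_p2gleGap hx 0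
    have hfy := natCast_p2gleGap hy 0
    rw [← h 0 (by omega)] at hfy
    rw [Function.iterate_zero_apply] at hfx hfy
    have hsub : p2gleT x - p2gleT y = 2 ^ (p2gleGap 0 x + 1) * (x - y) := by
      rw [p2gleT, p2gleT, ← hfx, ← hfy, ← Nat.cast_add_one, zpow_natCast]
      ring
    rw [hsub, abs_mul, abs_of_pos (by positivity)] at hT
    have h2 : (2 : ℝ) ≤ 2 ^ (p2gleGap 0 x + 1) := by
      rw [pow_succ]
      linarith [one_le_pow₀ (M₀ := ℝ) (a := 2) (by norm_num) (n := p2gleGap 0 x)]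
    have h3 := mul_le_mul_of_nonneg_right h2 (abs_nonneg (x - y))
    rw [pow_succ]
    linarith

theorem p2gleT_one : p2gleT 1 = 1 := by
  norm_num [p2gleT]

theorem p2gleT_eq_one_of_neg_logb {x : ℝ} (hx : 0 < x) {k : ℤ} (hk : -Real.logb 2 x = k) :
    p2gleT x = 1 := by
  have hpow : (2 : ℝ) ^ Real.logb 2 x = x := Real.rpow_logb (by norm_num) (by norm_num) hx
  have hx' : x = 2 ^ (-k) := by
    rw [← Real.rpow_intCast, Int.cast_neg, ← hk, neg_neg, hpow]
  rw [p2gleT, hk, Int.floor_intCast, hx', ← zpow_add₀ (by norm_num)]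
  norm_num

theorem p2gleD_eq_zero_of_iterate_eq_one {x : ℝ} {i j : ℕ} (h : p2gleT^[i] x = 1) (hij : i ≤ j) :
    p2gleD j x = 0 := by
  obtain ⟨k, rfl⟩ := Nat.exists_eq_add_of_le' hij
  rw [p2gleD, Function.iterate_add_apply, h, Function.iterate_fixed p2gleT_one]
  simp

theorem lyapLevelSet_log_two_subset_khinchinLevelSet_one :
    lyapLevelSet (Real.log 2) ⊆ khinchinLevelSet 1 := by
  rintro x ⟨hx, h⟩
  refine ⟨hx, ?_⟩
  have hlog : Real.log 2 ≠ 0 := (Real.log_pos (by norm_num)).ne'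
  have := h.div_const (Real.log 2)
  rw [div_self hlog] at this
  refine this.congr fun n => ?_
  rw [← Finset.sum_mul]
  field_simp

theorem p2gleD_eq_gap_add_one {x : ℝ} (hx : x ∈ khinchinLevelSet 1) (j : ℕ) :
    p2gleD j x = p2gleGap j x + 1 := by
  obtain ⟨hx, hlim⟩ := hx
  have hj := p2gleT_iterate_mem_Ioc hx j
  rw [natCast_p2gleGap hx, p2gleD]
  by_contra hne
  have hint : -Real.logb 2 (p2gleT^[j] x) = (⌊-Real.logb 2 (p2gleT^[j] x)⌋ : ℤ) := by
    have h1 := Int.ceil_le_floor_add_one (-Real.logb 2 (p2gleT^[j] x))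
    have h2 : ⌈-Real.logb 2 (p2gleT^[j] x)⌉ ≤ ⌊-Real.logb 2 (p2gleT^[j] x)⌋ := by omega
    exact le_antisymm ((Int.le_ceil _).trans (by exact_mod_cast h2)) (Int.floor_le _)
  have hone : p2gleT^[j + 1] x = 1 := by
    rw [Function.iterate_succ_apply']
    exact p2gleT_eq_one_of_neg_logb hj.1 hint
  have hzero : Tendsto (fun n : ℕ => (∑ i ∈ Finset.range n, (p2gleD i x : ℝ)) / n) atTop
      (nhds 0) := by
    refine (tendsto_const_div_atTop_nhds_zero_nat
      (∑ i ∈ Finset.range (j + 1), (p2gleD i x : ℝ))).congr' ?_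
    filter_upwards [eventually_ge_atTop (j + 1)] with n hn
    congr 1
    refine Finset.sum_subset (Finset.range_mono hn) fun i _ hi => ?_
    rw [p2gleD_eq_zero_of_iterate_eq_one hone (by simpa using hi), Int.cast_zero]
  exact zero_ne_one (tendsto_nhds_unique hzero hlim)

/-- The points whose first `n` gaps have mean at most `δ`, for every `n ≥ N`. -/
def smallGapSet (δ : ℝ) (N : ℕ) : Set ℝ :=
  {x ∈ Ioc (0 : ℝ) 1 | ∀ n ≥ N, ∑ j ∈ Finset.range n, (p2gleGap j x : ℝ) ≤ δ * n}

theorem khinchinLevelSet_one_subset_iUnion {δ : ℝ} (hδ : 0 < δ) :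
    khinchinLevelSet 1 ⊆ ⋃ N, smallGapSet δ N := by
  intro x hx
  have hD := p2gleD_eq_gap_add_one hx
  have hev := hx.2.eventually_lt_const (lt_add_of_pos_right 1 hδ)
  obtain ⟨N, hN⟩ := eventually_atTop.1 hev
  refine mem_iUnion.2 ⟨N + 1, hx.1, fun n hn => ?_⟩
  have hlt := hN n (by omega)
  have hn0 : (0 : ℝ) < n := by exact_mod_cast (by omega : 0 < n)
  rw [div_lt_iff₀ hn0] at hlt
  simp only [hD, Int.cast_add, Int.cast_natCast, Int.cast_one, Finset.sum_add_distrib,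
    Finset.sum_const, Finset.card_range, nsmul_eq_mul, mul_one] at hlt
  linarith

/-- The part of `smallGapSet δ N` lying in the cylinder of rank `n` with gaps `w`. -/
def gapCylinder (δ : ℝ) (N : ℕ) {n M : ℕ} (w : Fin n → Fin M) : Set ℝ :=
  {x ∈ smallGapSet δ N | ∀ j : Fin n, p2gleGap j x = w j}

theorem ediam_gapCylinder_le (δ : ℝ) (N : ℕ) {n M : ℕ} (w : Fin n → Fin M) :
    Metric.ediam (gapCylinder δ N w) ≤ ENNReal.ofReal ((1 / 2) ^ n) := by
  refine Metric.ediam_le fun x hx y hy => ?_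
  rw [edist_dist, Real.dist_eq]
  refine ENNReal.ofReal_le_ofReal (abs_sub_le_of_p2gleGap_eq hx.1.1 hy.1.1 fun j hj => ?_)
  exact (hx.2 ⟨j, hj⟩).trans (hy.2 ⟨j, hj⟩).symm

theorem ediam_gapCylinder_rpow_le {δ s r : ℝ} (hs : 0 < s) (hr : 0 < r) (hr1 : r < 1)
    {N n M : ℕ} (hn : N ≤ n) (w : Fin n → Fin M) :
    Metric.ediam (gapCylinder δ N w) ^ s ≤
      ENNReal.ofReal (((1 / 2) ^ s / r ^ δ) ^ n * ∏ j, r ^ (w j : ℕ)) := by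
  rcases (gapCylinder δ N w).eq_empty_or_nonempty with h | ⟨x, hx⟩
  · simp [h, hs]
  have hsum : ((∑ j, (w j : ℕ) : ℕ) : ℝ) ≤ δ * n := by
    have h := hx.1.2 n hn
    rw [Finset.sum_range] at h
    simpa [hx.2] using h
  refine (ENNReal.rpow_le_rpow (ediam_gapCylinder_le δ N w) hs.le).trans ?_
  rw [ENNReal.ofReal_rpow_of_nonneg (by positivity) hs.le]
  refine ENNReal.ofReal_le_ofReal ?_
  have hδ : (r ^ δ) ^ n ≤ ∏ j, r ^ (w j : ℕ) := by
    rw [Finset.prod_pow_eq_pow_sum, ← Real.rpow_natCast, ← Real.rpow_natCast, ← Real.rpow_mul hr.le]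
    exact Real.rpow_le_rpow_of_exponent_ge hr hr1.le hsum
  have hcomm : (((1 : ℝ) / 2) ^ n) ^ s = ((1 / 2) ^ s) ^ n :=
    (Real.rpow_pow_comm (by norm_num) s n).symm
  rw [hcomm, div_pow, div_mul_eq_mul_div, le_div_iff₀ (by positivity)]
  gcongr

theorem hausdorffMeasure_smallGapSet_eq_zero {δ s r : ℝ} (hs : 0 < s) (hr : 0 < r) (hr1 : r < 1)
    (hδ : δ ≤ 1) (h : (1 / 2) ^ s / r ^ δ * (1 - r)⁻¹ < 1) (N : ℕ) :
    μH[s] (smallGapSet δ N) = 0 := by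
  set c : ℝ := (1 / 2) ^ s / r ^ δ * (1 - r)⁻¹ with hc
  have hc0 : 0 ≤ c := by
    have : 0 < 1 - r := by linarith
    positivity
  have hsum : ∀ n ≥ N, ∑ w : Fin n → Fin (n + 1), Metric.ediam (gapCylinder δ N w) ^ s ≤
      ENNReal.ofReal (c ^ n) := fun n hn => by
    refine (Finset.sum_le_sum fun w _ => ediam_gapCylinder_rpow_le hs hr hr1 hn w).trans ?_
    rw [← ENNReal.ofReal_sum_of_nonneg fun w _ => by positivity, ← Finset.mul_sum]
    refine ENNReal.ofReal_le_ofReal ?_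
    have hgeom : ∑ a : Fin (n + 1), r ^ (a : ℕ) ≤ (1 - r)⁻¹ := by
      rw [← Finset.sum_range (fun a => r ^ a), ← tsum_geometric_of_lt_one hr.le hr1]
      exact (summable_geometric_of_lt_one hr.le hr1).sum_le_tsum _ fun _ _ => by positivity
    rw [← Fintype.sum_pow (fun a : Fin (n + 1) => r ^ (a : ℕ)) n, hc, mul_pow]
    gcongr
  have hcover : ∀ n ≥ N, smallGapSet δ N ⊆ ⋃ w : Fin n → Fin (n + 1), gapCylinder δ N w := by
    intro n hn x hx
    have hle : ∀ j : Fin n, p2gleGap j x < n + 1 := fun j => by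
      have h1 : (p2gleGap j x : ℝ) ≤ ∑ i ∈ Finset.range n, (p2gleGap i x : ℝ) :=
        Finset.single_le_sum (f := fun i => (p2gleGap i x : ℝ)) (fun _ _ => by positivity)
          (Finset.mem_range.2 j.2)
      have h2 : (p2gleGap j x : ℝ) ≤ n := by
        nlinarith [hx.2 n hn, Nat.cast_nonneg (α := ℝ) n]
      exact Nat.lt_succ_of_le (by exact_mod_cast h2)
    exact mem_iUnion.2 ⟨fun j => ⟨p2gleGap j x, hle j⟩, hx, fun _ => rfl⟩
  have hlim : ∀ {a : ℝ}, 0 ≤ a → a < 1 →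
      Tendsto (fun n : ℕ => ENNReal.ofReal (a ^ n)) atTop (nhds 0) := fun h0 h1 => by
    simpa using ENNReal.tendsto_ofReal (tendsto_pow_atTop_nhds_zero_of_lt_one h0 h1)
  refine le_antisymm ?_ zero_le
  calc μH[s] (smallGapSet δ N)
      ≤ liminf (fun n : ℕ => ∑ w : Fin n → Fin (n + 1),
          Metric.ediam (gapCylinder δ N w) ^ s) atTop :=
        Measure.hausdorffMeasure_le_liminf_sum s (smallGapSet δ N)
          (fun n : ℕ => ENNReal.ofReal ((1 / 2) ^ n)) (hlim (by norm_num) (by norm_num))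
          (fun n w => gapCylinder δ N w)
          (Eventually.of_forall fun n w => ediam_gapCylinder_le δ N w)
          (eventually_atTop.2 ⟨N, hcover⟩)
    _ ≤ liminf (fun n : ℕ => ENNReal.ofReal (c ^ n)) atTop :=
        liminf_le_liminf (eventually_atTop.2 ⟨N, hsum⟩)
    _ = 0 := (hlim hc0 h).liminf_eq

theorem exists_gap_parameters {s : ℝ} (hs : 0 < s) :
    ∃ r δ : ℝ, 0 < r ∧ r < 1 ∧ 0 < δ ∧ δ ≤ 1 ∧ (1 / 2) ^ s / r ^ δ * (1 - r)⁻¹ < 1 := by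
  set u : ℝ := (1 / 2) ^ (s / 2) with hu
  have hu0 : 0 < u := by positivity
  have hu1 : u < 1 := Real.rpow_lt_one (by norm_num) (by norm_num) (by linarith)
  have hr0 : 0 < (1 - u) / 2 := by linarith
  have hr1 : (1 - u) / 2 < 1 := by linarith
  have hsq : (1 / 2 : ℝ) ^ s = u * u := by
    rw [hu, ← Real.rpow_add (by norm_num), add_halves]
  have hδ0 : 0 < Real.logb ((1 - u) / 2) u := Real.logb_pos_of_base_lt_one hr0 hr1 hu0 hu1
  refine ⟨(1 - u) / 2, min 1 (Real.logb ((1 - u) / 2) u), hr0, hr1, lt_min one_pos hδ0,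
    min_le_left _ _, ?_⟩
  have hrδ : u ≤ ((1 - u) / 2) ^ min 1 (Real.logb ((1 - u) / 2) u) := by
    calc u = ((1 - u) / 2) ^ Real.logb ((1 - u) / 2) u := (Real.rpow_logb hr0 hr1.ne hu0).symm
      _ ≤ _ := Real.rpow_le_rpow_of_exponent_ge hr0 hr1.le (min_le_right _ _)
  have hle : (1 / 2) ^ s / ((1 - u) / 2) ^ min 1 (Real.logb ((1 - u) / 2) u) ≤ u := by
    rw [hsq, div_le_iff₀ (hu0.trans_le hrδ)]
    gcongr
  rw [← div_eq_mul_inv, div_lt_one (by linarith)]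
  linarith

theorem dimH_khinchinLevelSet_one : dimH (khinchinLevelSet 1) = 0 := by
  refine le_antisymm (dimH_le fun d hd => ?_) zero_le
  by_contra hpos
  have hd0 : (0 : ℝ) < d := by simpa [pos_iff_ne_zero] using hpos
  obtain ⟨r, δ, hr, hr1, hδ, hδ1, h⟩ := exists_gap_parameters hd0
  have hzero : μH[(d : ℝ)] (khinchinLevelSet 1) = 0 :=
    measure_mono_null (khinchinLevelSet_one_subset_iUnion hδ)
      (measure_iUnion_null (hausdorffMeasure_smallGapSet_eq_zero hd0 hr hr1 hδ1 h))
  simp [hzero] at hd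

theorem dimH_lyapunov_log_two : dimH (lyapLevelSet (Real.log 2)) = 0 :=
  le_antisymm ((dimH_mono lyapLevelSet_log_two_subset_khinchinLevelSet_one).trans
    dimH_khinchinLevelSet_one.le) zero_le
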